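/- arXiv:2007.05896 — 2 statements merged into one kernel-verified Lean document; each statement's English description precedes it below -/
import Mathlib

section
/- Let S and A be finite nonempty types, let P₁, P₂ : S → A → PMF S be two transition kernels satisfying ∑_{s' ∈ S} |(P₁ s a s').toReal − (P₂ s a s').toReal| ≤ α for all s ∈ S and a ∈ A (where α ≥ 0), and let R : S → A → ℝ be a common reward function with 0 ≤ R s a ≤ Rmax for all s, a. For any time-dependent policy π : ℕ → S → A, define the h-step value functions recursively by Vᵢ^π(0, s) = 0 and Vᵢ^π(h+1, s) = R(s, π h s) + ∑_{s' ∈ S} (Pᵢ s (π h s) s').toReal · Vᵢ^π(h, s') for i = 1, 2. Then for every policy π, every h ∈ ℕ, and every s ∈ S, |V₁^π(h, s) − V₂^π(h, s)| ≤ α · Rmax · h·(h−1)/2. -/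
/-- The `h`-step value function of a time-dependent policy `π` in a finite
stochastic MDP with transition kernel `P` and reward function `R`. -/
noncomputable def stochVal {S A : Type*} [Fintype S]
    (P : S → A → PMF S) (R : S → A → ℝ) (π : ℕ → S → A) : ℕ → S → ℝ
  | 0, _ => 0
  | h + 1, s =>
      R s (π h s) + ∑ s' : S, (P s (π h s) s').toReal * stochVal P R π h s'

theorem PMF.sum_toReal_eq_one {S : Type*} [Fintype S] (p : PMF S) :
    ∑ s : S, (p s).toReal = 1 := by
  rw [← ENNReal.toReal_sum fun s _ => p.apply_ne_top s, ← tsum_fintype (L := .unconditional S),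
    p.tsum_coe, ENNReal.toReal_one]

theorem PMF.sum_toReal_mul_le {S : Type*} [Fintype S] (p : PMF S) {f : S → ℝ} {c : ℝ}
    (hf : ∀ s, f s ≤ c) : ∑ s : S, (p s).toReal * f s ≤ c :=
  calc ∑ s : S, (p s).toReal * f s ≤ ∑ s : S, (p s).toReal * c :=
        Finset.sum_le_sum fun s _ => mul_le_mul_of_nonneg_left (hf s) ENNReal.toReal_nonneg
    _ = c := by rw [← Finset.sum_mul, p.sum_toReal_eq_one, one_mul]

theorem abs_stochVal_le {S A : Type*} [Fintype S] (P : S → A → PMF S) {R : S → A → ℝ}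
    {Rmax : ℝ} (hR : ∀ s a, |R s a| ≤ Rmax) (π : ℕ → S → A) (h : ℕ) (s : S) :
    |stochVal P R π h s| ≤ h * Rmax := by
  induction h generalizing s with
  | zero => simp [stochVal]
  | succ h ih =>
    have hsum : |∑ s' : S, (P s (π h s) s').toReal * stochVal P R π h s'| ≤ h * Rmax := by
      refine (Finset.abs_sum_le_sum_abs _ _).trans ?_
      simp only [abs_mul, abs_of_nonneg ENNReal.toReal_nonneg]
      exact PMF.sum_toReal_mul_le _ ih
    rw [stochVal]
    push_cast
    linarith [abs_add_le (R s (π h s))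
      (∑ s' : S, (P s (π h s) s').toReal * stochVal P R π h s'), hR s (π h s)]

theorem stoch_value_transition_perturbation
    {S A : Type*} [Fintype S] [Nonempty S] [Fintype A] [Nonempty A]
    (P₁ P₂ : S → A → PMF S) (R : S → A → ℝ) (α Rmax : ℝ) (hα : 0 ≤ α)
    (hP : ∀ s a, ∑ s' : S, |(P₁ s a s').toReal - (P₂ s a s').toReal| ≤ α)
    (hR : ∀ s a, 0 ≤ R s a ∧ R s a ≤ Rmax) :
    ∀ (π : ℕ → S → A) (h : ℕ) (s : S),
      |stochVal P₁ R π h s - stochVal P₂ R π h s| ≤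
        α * Rmax * ((h : ℝ) * ((h : ℝ) - 1) / 2) := by
  intro π h
  have hRabs : ∀ s a, |R s a| ≤ Rmax := fun s a => by
    rw [abs_of_nonneg (hR s a).1]
    exact (hR s a).2
  have hRmax : 0 ≤ Rmax :=
    (abs_nonneg _).trans (hRabs (Classical.arbitrary S) (Classical.arbitrary A))
  induction h with
  | zero => simp [stochVal]
  | succ h ih =>
    intro s
    set p := P₁ s (π h s)
    set q := P₂ s (π h s)
    set V := stochVal P₁ R π h
    set W := stochVal P₂ R π h
    have hsplit : stochVal P₁ R π (h + 1) s - stochVal P₂ R π (h + 1) s =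
        ∑ s' : S, ((p s').toReal - (q s').toReal) * V s' +
          ∑ s' : S, (q s').toReal * (V s' - W s') := by
      simp only [stochVal, sub_mul, mul_sub, Finset.sum_sub_distrib, p, q, V, W]
      ring
    have hkernel : |∑ s' : S, ((p s').toReal - (q s').toReal) * V s'| ≤ α * (h * Rmax) :=
      calc |∑ s' : S, ((p s').toReal - (q s').toReal) * V s'|
          ≤ ∑ s' : S, |(p s').toReal - (q s').toReal| * (h * Rmax) := by
            refine (Finset.abs_sum_le_sum_abs _ _).trans (Finset.sum_le_sum fun s' _ => ?_)
            rw [abs_mul]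
            exact mul_le_mul_of_nonneg_left (abs_stochVal_le P₁ hRabs π h s') (abs_nonneg _)
        _ ≤ α * (h * Rmax) := by
            rw [← Finset.sum_mul]
            exact mul_le_mul_of_nonneg_right (hP s (π h s)) (by positivity)
    have hvalue : |∑ s' : S, (q s').toReal * (V s' - W s')| ≤
        α * Rmax * ((h : ℝ) * ((h : ℝ) - 1) / 2) := by
      refine (Finset.abs_sum_le_sum_abs _ _).trans ?_
      simp only [abs_mul, abs_of_nonneg ENNReal.toReal_nonneg]
      exact q.sum_toReal_mul_le ih
    rw [hsplit]
    refine (abs_add_le _ _).trans ((add_le_add hkernel hvalue).trans_eq ?_)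
    push_cast
    ring
end

section
/- Let S and A be finite nonempty types, T : S → A → S a transition function, R : S → A → ℝ a reward function, and s₀ ∈ S a start state. For an action sequence a : Fin L → A (of any length L), define the induced trajectory by x₀ = s₀ and x_{t+1} = T x_t (a t), its endpoint x_L, and its total reward ∑_{t < L} R(x_t, a t). Suppose rewards are path-independent from s₀, witnessed by a function ρ : S → ℝ such that every action sequence of every length from s₀ with endpoint s has total reward equal to ρ(s). For a time-dependent policy π : ℕ → S → A, define the h-step value function recursively by V^π(0, s) = 0 and V^π(h+1, s) = R(s, π h s) + V^π(h, T s (π h s)). Then for every horizon H, the maximum of V^π(H, s₀) over all time-dependent policies π : ℕ → S → A equals the maximum of ρ(s) over the set of states s that are reachable from s₀ by some action sequence of length exactly H. -/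
/-- The `h`-step value function of a time-dependent policy `π` in a finite
deterministic MDP with transition function `T` and reward function `R`. -/
def detVal {S A : Type*} (T : S → A → S) (R : S → A → ℝ) (π : ℕ → S → A) : ℕ → S → ℝ
  | 0, _ => 0
  | h + 1, s => R s (π h s) + detVal T R π h (T s (π h s))

/-- The endpoint of the trajectory induced from start state `s₀` by the
open-loop action sequence `a : Fin L → A`: `x₀ = s₀`, `x_{t+1} = T x_t (a t)`,
returns `x_L`. -/
def trajEnd {S A : Type*} (T : S → A → S) (s₀ : S) : {L : ℕ} → (Fin L → A) → S
  | 0, _ => s₀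
  | L + 1, a => T (trajEnd T s₀ (fun i : Fin L => a i.castSucc)) (a (Fin.last L))

theorem add_detVal_trajEnd {S A : Type*} (T : S → A → S) (R : S → A → ℝ) (s₀ : S) (ρ : S → ℝ)
    (c : ℕ → A) (π : ℕ → S → A) (H : ℕ)
    (hρ : ∀ L : ℕ, ρ (trajEnd T s₀ (fun i : Fin (L + 1) => c i)) =
      ρ (trajEnd T s₀ (fun i : Fin L => c i)) + R (trajEnd T s₀ (fun i : Fin L => c i)) (c L))
    (hπ : ∀ L k : ℕ, L + (k + 1) = H → π k (trajEnd T s₀ (fun i : Fin L => c i)) = c L) :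
    ∀ k L : ℕ, L + k = H →
      ρ (trajEnd T s₀ (fun i : Fin L => c i)) +
        detVal T R π k (trajEnd T s₀ (fun i : Fin L => c i)) =
      ρ (trajEnd T s₀ (fun i : Fin H => c i)) := by
  intro k
  induction k with
  | zero =>
    rintro L rfl
    simp [detVal]
  | succ k ih =>
    intro L hL
    rw [← ih (L + 1) (by omega), hρ, detVal, hπ L k hL, add_assoc]
    rfl

theorem trajEnd_eq_of_step {S A : Type*} (T : S → A → S) (c : ℕ → A) (x : ℕ → S)
    (hx : ∀ n, x (n + 1) = T (x n) (c n)) (L : ℕ) :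
    trajEnd T (x 0) (fun i : Fin L => c i) = x L := by
  induction L with
  | zero => rfl
  | succ L ih => rw [hx, ← ih]; rfl

theorem det_path_independent_optimal_value
    {S A : Type*} [Fintype S] [Nonempty S] [Fintype A] [Nonempty A]
    (T : S → A → S) (R : S → A → ℝ) (s₀ : S) (ρ : S → ℝ)
    (hρ : ∀ (L : ℕ) (a : Fin L → A),
      (∑ t : Fin L,
          R (trajEnd T s₀ (fun i : Fin t.val => a (i.castLE t.isLt.le))) (a t)) =
        ρ (trajEnd T s₀ a))
    (H : ℕ) :
    (⨆ π : ℕ → S → A, detVal T R π H s₀) =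
      sSup (ρ '' {s : S | ∃ a : Fin H → A, trajEnd T s₀ a = s}) := by
  have hstep : ∀ (c : ℕ → A) (L : ℕ), ρ (trajEnd T s₀ (fun i : Fin (L + 1) => c i)) =
      ρ (trajEnd T s₀ (fun i : Fin L => c i)) +
        R (trajEnd T s₀ (fun i : Fin L => c i)) (c L) := by
    intro c L
    rw [← hρ, ← hρ, Fin.sum_univ_castSucc]
    rfl
  have hzero : ρ s₀ = 0 := by
    simpa [trajEnd] using (hρ 0 Fin.elim0).symm
  have hval : ∀ (c : ℕ → A) (π : ℕ → S → A),
      (∀ L k : ℕ, L + (k + 1) = H → π k (trajEnd T s₀ (fun i : Fin L => c i)) = c L) →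
      detVal T R π H s₀ = ρ (trajEnd T s₀ (fun i : Fin H => c i)) := by
    intro c π hπ
    have h := add_detVal_trajEnd T R s₀ ρ c π H (hstep c) hπ H 0 (Nat.zero_add H)
    simpa [trajEnd, hzero] using h
  rw [iSup]
  congr 1
  ext r
  constructor
  · rintro ⟨π, rfl⟩
    let x : ℕ → S := fun n => Nat.rec s₀ (fun t s => T s (π (H - 1 - t) s)) n
    let c : ℕ → A := fun t => π (H - 1 - t) (x t)
    refine ⟨_, ⟨fun i : Fin H => c i, rfl⟩, (hval c π fun L k hL => ?_).symm⟩
    have hx : trajEnd T s₀ (fun i : Fin L => c i) = x L :=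
      trajEnd_eq_of_step T c x (fun _ => rfl) L
    have hk : H - 1 - L = k := by omega
    rw [hx, ← hk]
  · rintro ⟨_, ⟨a, rfl⟩, rfl⟩
    let c : ℕ → A := fun t => if h : t < H then a ⟨t, h⟩ else Classical.arbitrary A
    have hc : (fun i : Fin H => c i) = a := by
      funext i
      simp [c]
    refine ⟨fun k _ => c (H - 1 - k), ?_⟩
    rw [← hc]
    refine hval c _ fun L k hL => ?_
    have hk : H - 1 - k = L := by omega
    rw [hk]
end
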